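/- Let (Q,q,k) be a regular local ring and I1, I2 ⊆ q^2 q-primary ideals with Gorenstein quotients R1, R2 of socle degrees s1 ≤ s2 and initial degrees t1, t2. If R = Q/(I1 ∩ I2) has type 2 and ⌈(s2+1)/2⌉ = t2, then t1 ≤ t2 ≤ s1 ≤ s2 < 2 s1. -/

import Mathlib

open IsLocalRing

/-- A Noetherian local ring is regular if its maximal ideal is generated by a
regular sequence. -/
def IsRegularLocal (Q : Type*) [CommRing Q] [IsLocalRing Q] : Prop :=
  ∃ L : List Q, RingTheory.Sequence.IsRegular Q L ∧
    Ideal.span {x | x ∈ L} = maximalIdeal Q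

/-- `σ` is the socle degree of `Q/J`. -/
def SocDeg {Q : Type*} [CommRing Q] [IsLocalRing Q] (J : Ideal Q) (σ : ℕ) : Prop :=
  ¬ maximalIdeal Q ^ σ ≤ J ∧ maximalIdeal Q ^ (σ + 1) ≤ J

/-- `τ` is the initial degree of `J`. -/
def IniDeg {Q : Type*} [CommRing Q] [IsLocalRing Q] (J : Ideal Q) (τ : ℕ) : Prop :=
  J ≤ maximalIdeal Q ^ τ ∧ ¬ J ≤ maximalIdeal Q ^ (τ + 1)

/-- `Q/J` has type 1 (is artinian Gorenstein). -/
def HasTypeOne {Q : Type*} [CommRing Q] [IsLocalRing Q] (J : Ideal Q) : Prop :=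
  ∃ x : Q, x ∉ J ∧ J.colon (maximalIdeal Q) = J ⊔ Ideal.span {x}

/-- `Q/J` has type 2. -/
def HasTypeTwo {Q : Type*} [CommRing Q] [IsLocalRing Q] (J : Ideal Q) : Prop :=
  ∃ x y : Q, J.colon (maximalIdeal Q) = J ⊔ Ideal.span {x, y} ∧
    ∀ a b : Q, a * x + b * y ∈ J → a ∈ maximalIdeal Q ∧ b ∈ maximalIdeal Q

/-- The ideal generated by the members of a family indexed by a finset. -/
def famSpan {Q ι : Type*} [CommRing Q] (x : ι → Q) (A : Finset ι) : Ideal Q :=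
  Ideal.span (x '' (A : Set ι))

/-- Every subfamily is regular in every order. -/
def PermReg {Q ι : Type*} [CommRing Q] (x : ι → Q) : Prop :=
  ∀ (A : Finset ι) (i : ι), i ∉ A → ∀ a, x i * a ∈ famSpan x A → a ∈ famSpan x A

theorem famSpan_insert {Q ι : Type*} [CommRing Q] [DecidableEq ι] (x : ι → Q) (A : Finset ι)
    (i : ι) : famSpan x (insert i A) = Ideal.span {x i} ⊔ famSpan x A := by
  unfold famSpan
  rw [Finset.coe_insert, Set.image_insert_eq, Ideal.span_insert]

theorem famSpan_empty {Q ι : Type*} [CommRing Q] (x : ι → Q) :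
    famSpan x ∅ = ⊥ := by
  simp [famSpan]

theorem pow_sup_le {Q : Type*} [CommRing Q] (Y P : Ideal Q) (m : ℕ) :
    (Y ⊔ P) ^ (m + 1) ≤ Y * (Y ⊔ P) ^ m ⊔ P ^ (m + 1) := by
  induction m with
  | zero => simp
  | succ m ih =>
    rw [pow_succ' (Y ⊔ P) (m + 1), Ideal.sup_mul]
    refine sup_le le_sup_left ?_
    refine (Ideal.mul_mono_right ih).trans ?_
    rw [Ideal.mul_sup]
    refine sup_le (le_sup_of_le_left ?_) (le_sup_of_le_right (by rw [← pow_succ']))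
    rw [← mul_assoc, mul_comm P Y, mul_assoc]
    refine Ideal.mul_mono_right ?_
    rw [pow_succ' (Y ⊔ P) m]
    exact Ideal.mul_mono_left le_sup_right

theorem sup_mono_right {Q : Type*} [CommRing Q] (K : Ideal Q) {P P' : Ideal Q} (h : P ≤ P') :
    K ⊔ P ≤ K ⊔ P' := sup_le_sup_left h K

/-- decomposition of an element of `K + (y, P)^(m+1)`. -/
theorem decomp {Q : Type*} [CommRing Q] (K P : Ideal Q) (y : Q) (m : ℕ) {a : Q}
    (h : a ∈ K ⊔ (Ideal.span {y} ⊔ P) ^ (m + 1)) :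
    ∃ b ∈ (Ideal.span {y} ⊔ P) ^ m, a - y * b ∈ K ⊔ P ^ (m + 1) := by
  have h2 : a ∈ K ⊔ (Ideal.span {y} * (Ideal.span {y} ⊔ P) ^ m ⊔ P ^ (m + 1)) :=
    sup_mono_right K (pow_sup_le _ _ _) h
  rw [sup_left_comm] at h2
  obtain ⟨c, hc, d, hd, rfl⟩ := Submodule.mem_sup.1 h2
  obtain ⟨b, hb, rfl⟩ := Ideal.mem_span_singleton_mul.1 hc
  exact ⟨b, hb, by simpa using hd⟩

theorem reg_pow {Q ι : Type*} [CommRing Q] [DecidableEq ι] (x : ι → Q) (hx : PermReg x)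
    (B : Finset ι) : ∀ (A : Finset ι) (i : ι), Disjoint A B → i ∉ A → i ∉ B → ∀ (m : ℕ) (a : Q),
      x i * a ∈ famSpan x A ⊔ famSpan x B ^ m → a ∈ famSpan x A ⊔ famSpan x B ^ m := by
  induction B using Finset.induction_on with
  | empty =>
    intro A i _ hA _ m a h
    cases m with
    | zero => simp
    | succ m =>
      have hb : (⊥ : Ideal Q) ^ (m + 1) = ⊥ := by
        rw [pow_succ, Ideal.mul_bot]
      rw [famSpan_empty, hb, sup_bot_eq] at h ⊢
      exact hx A i hA a h
  | insert y B hyB ih =>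
    intro A i hd hA hB m
    rw [famSpan_insert]
    rw [Finset.disjoint_insert_right] at hd
    rw [Finset.mem_insert, not_or] at hB
    induction m with
    | zero => intro a _; simp
    | succ m ihm =>
      intro a h
      obtain ⟨e, he, hae⟩ := decomp _ _ _ _ h
      have h1 : x i * a ∈ famSpan x (insert y A) ⊔ famSpan x B ^ (m + 1) := by
        rw [famSpan_insert, sup_assoc]
        have : x i * a = x y * e + (x i * a - x y * e) := by ring
        rw [this]
        exact Submodule.add_mem_sup
          (Ideal.mul_mem_right _ _ (Ideal.mem_span_singleton_self _)) hae
      have h2 := ih (insert y A) i (by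
        rw [Finset.disjoint_insert_left]; exact ⟨hyB, hd.2⟩)
        (by rw [Finset.mem_insert, not_or]; exact ⟨hB.1, hA⟩) hB.2 _ _ h1
      rw [famSpan_insert, sup_assoc] at h2
      obtain ⟨yb, hyb, c, hc, rfl⟩ := Submodule.mem_sup.1 h2
      obtain ⟨b, rfl⟩ := Ideal.mem_span_singleton'.1 hyb
      have h3 : x y * (x i * b - e) ∈ famSpan x A ⊔ famSpan x B ^ (m + 1) := by
        have : x y * (x i * b - e) = (x i * (b * x y + c) - x y * e) - x i * c := by ring
        rw [this]
        exact Ideal.sub_mem _ hae (Ideal.mul_mem_left _ _ hc)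
      have h4 := ih A y hd.2 hd.1 hyB _ _ h3
      have hle : famSpan x A ⊔ famSpan x B ^ (m + 1) ≤
          famSpan x A ⊔ (Ideal.span {x y} ⊔ famSpan x B) ^ m :=
        sup_le_sup_left ((Ideal.pow_le_pow_right (Nat.le_succ m)).trans
          (Ideal.pow_right_mono le_sup_right m)) _
      have h5 : x i * b ∈ famSpan x A ⊔ (Ideal.span {x y} ⊔ famSpan x B) ^ m := by
        have : x i * b = (x i * b - e) + e := by ring
        rw [this]
        exact Ideal.add_mem _ (hle h4) (Ideal.mem_sup_right he)
      have h6 := ihm b h5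
      refine Ideal.add_mem _ ?_ (sup_mono_right _ (Ideal.pow_right_mono le_sup_right _) hc)
      obtain ⟨k, hk, p, hp, rfl⟩ := Submodule.mem_sup.1 h6
      rw [add_mul]
      refine Submodule.add_mem_sup (Ideal.mul_mem_right _ _ hk) ?_
      rw [pow_succ]
      exact Ideal.mul_mem_mul hp (Ideal.mem_sup_left (Ideal.mem_span_singleton_self _))

/-- Independent families in `(x_B)^d` modulo `K + (x_B)^(d+1)`. -/
theorem exists_indep {Q ι : Type*} [CommRing Q] [IsLocalRing Q] [DecidableEq ι] (x : ι → Q)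
    (hx : PermReg x) (hm : ∀ i, x i ∈ maximalIdeal Q) (B : Finset ι) :
    ∀ (A : Finset ι), Disjoint A B → maximalIdeal Q ≤ famSpan x A ⊔ famSpan x B → ∀ d : ℕ,
      ∃ v : Fin (Nat.multichoose B.card d) → Q, (∀ j, v j ∈ famSpan x B ^ d) ∧
        ∀ c : Fin (Nat.multichoose B.card d) → Q,
          ∑ j, c j * v j ∈ famSpan x A ⊔ famSpan x B ^ (d + 1) →
          ∀ j, c j ∈ maximalIdeal Q := by
  have hfam : ∀ A : Finset ι, famSpan x A ≤ maximalIdeal Q := by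
    intro A
    refine Ideal.span_le.2 ?_
    rintro _ ⟨i, _, rfl⟩
    exact hm i
  have hzero : ∀ (A B : Finset ι),
      ∃ v : Fin (Nat.multichoose B.card 0) → Q, (∀ j, v j ∈ famSpan x B ^ 0) ∧
        ∀ c : Fin (Nat.multichoose B.card 0) → Q,
          ∑ j, c j * v j ∈ famSpan x A ⊔ famSpan x B ^ (0 + 1) →
          ∀ j, c j ∈ maximalIdeal Q := by
    intro A B
    rw [Nat.multichoose_zero_right]
    refine ⟨fun _ => 1, by simp, fun c hc j => ?_⟩
    simp only [mul_one, Finset.univ_unique, Finset.sum_singleton, zero_add, pow_one] at hc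
    have := sup_le (hfam A) (hfam B) hc
    rwa [Subsingleton.elim j default]
  induction B using Finset.induction_on with
  | empty =>
    intro A _ _ d
    cases d with
    | zero => exact hzero A ∅
    | succ d =>
      rw [Finset.card_empty, Nat.multichoose_zero_succ]
      exact ⟨fun _ => 0, fun j => j.elim0, fun c _ j => j.elim0⟩
  | insert y B hyB ih =>
    intro A hd hq d
    induction d with
    | zero => exact hzero A _
    | succ d ihd =>
      rw [Finset.disjoint_insert_right] at hd
      rw [Finset.card_insert_of_notMem hyB] at ihd ⊢
      obtain ⟨v, hv, hvi⟩ := ihd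
      obtain ⟨w, hw, hwi⟩ := ih (insert y A) (by
        rw [Finset.disjoint_insert_left]; exact ⟨hyB, hd.2⟩) (by
          rw [famSpan_insert] at hq ⊢
          rwa [sup_assoc, sup_left_comm]) (d + 1)
      rw [famSpan_insert] at hv hvi hwi hq ⊢
      rw [Nat.multichoose_succ_succ]
      refine ⟨Fin.append w (fun j => x y * v j), ?_, ?_⟩
      · intro j
        refine Fin.addCases (fun j => ?_) (fun j => ?_) j
        · rw [Fin.append_left]
          exact Ideal.pow_right_mono le_sup_right _ (hw j)
        · rw [Fin.append_right, pow_succ']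
          exact Ideal.mul_mem_mul (Ideal.mem_sup_left (Ideal.mem_span_singleton_self _)) (hv j)
      · intro c hc
        rw [Fin.sum_univ_add] at hc
        simp only [Fin.append_left, Fin.append_right] at hc
        have hsum : ∑ j, c (Fin.natAdd _ j) * (x y * v j)
            = x y * ∑ j, c (Fin.natAdd _ j) * v j := by
          rw [Finset.mul_sum]
          exact Finset.sum_congr rfl fun j _ => by ring
        rw [hsum] at hc
        obtain ⟨b, hb, hbc⟩ := decomp _ _ _ _ hc
        have h1 := hwi (fun j => c (Fin.castAdd _ j)) (by
          have : ∑ j, c (Fin.castAdd _ j) * w j =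
            x y * (b - ∑ j, c (Fin.natAdd _ j) * v j) +
             ((∑ j, c (Fin.castAdd _ j) * w j + x y * ∑ j, c (Fin.natAdd _ j) * v j)
              - x y * b) := by ring
          rw [this, sup_assoc]
          exact Submodule.add_mem_sup
            (Ideal.mul_mem_right _ _ (Ideal.mem_span_singleton_self _)) hbc)
        have h2 : ∑ j, c (Fin.castAdd _ j) * w j ∈
            famSpan x A ⊔ (Ideal.span {x y} ⊔ famSpan x B) ^ (d + 1 + 1) := by
          refine Ideal.sum_mem _ fun j _ => ?_
          obtain ⟨k, hk, p, hp, hkp⟩ := Submodule.mem_sup.1 (hq (h1 j))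
          rw [← hkp, add_mul]
          refine Submodule.add_mem_sup (Ideal.mul_mem_right _ _ hk) ?_
          rw [pow_succ' _ (d + 1)]
          exact Ideal.mul_mem_mul hp (Ideal.pow_right_mono le_sup_right _ (hw j))
        have h3 : x y * ∑ j, c (Fin.natAdd _ j) * v j ∈
            famSpan x A ⊔ (Ideal.span {x y} ⊔ famSpan x B) ^ (d + 1 + 1) := by
          have := Ideal.sub_mem _ hc h2
          rwa [add_sub_cancel_left] at this
        obtain ⟨e, he, hec⟩ := decomp _ _ _ _ h3
        rw [← mul_sub] at hec
        have h4 := reg_pow x hx B A y hd.2 hd.1 hyB _ _ hec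
        have h5 := hvi (fun j => c (Fin.natAdd _ j)) (by
          have : ∑ j, c (Fin.natAdd _ j) * v j = (∑ j, c (Fin.natAdd _ j) * v j - e) + e := by
            ring
          rw [this]
          exact Ideal.add_mem _ (sup_mono_right _
            ((Ideal.pow_le_pow_right (Nat.le_succ _)).trans
              (Ideal.pow_right_mono le_sup_right _)) h4) (Ideal.mem_sup_right he))
        intro j
        exact Fin.addCases h1 h5 j

/-- An ideal containing `q^d` has at most as many generators as `q^d`. -/
theorem gens_bound {Q ι : Type*} [CommRing Q] [IsLocalRing Q] [DecidableEq ι] (x : ι → Q)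
    (hm : ∀ i, x i ∈ maximalIdeal Q) (B : Finset ι) (hB : B.Nonempty) :
    ∀ (d : ℕ) (K J : Ideal Q), maximalIdeal Q ≤ K ⊔ famSpan x B → K ≤ J →
      maximalIdeal Q ^ d ≤ J →
      ∃ S : Finset Q, S.card ≤ Nat.multichoose B.card d ∧ (∀ s ∈ S, s ∈ J) ∧
        J ≤ K ⊔ Ideal.span (S : Set Q) := by
  classical
  have htop : ∀ (J K : Ideal Q) (n : ℕ), 1 ≤ n → J = ⊤ →
      ∃ S : Finset Q, S.card ≤ n ∧ (∀ s ∈ S, s ∈ J) ∧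
        J ≤ K ⊔ Ideal.span (S : Set Q) := by
    rintro J K n hn rfl
    refine ⟨{1}, by simpa using hn, by simp, ?_⟩
    refine le_sup_of_le_right ?_
    simp
  have hcol : ∀ (J : Ideal Q) (y : Q) (d : ℕ), y ∈ maximalIdeal Q →
      maximalIdeal Q ^ (d + 1) ≤ J → maximalIdeal Q ^ d ≤ J.colon {y} := by
    intro J y d hy h a ha
    rw [Submodule.mem_colon_singleton, smul_eq_mul]
    exact h (by rw [pow_succ]; exact Ideal.mul_mem_mul ha hy)
  have hmulS : ∀ (K : Ideal Q) (y : Q) (S : Finset Q) (b : Q), b ∈ K ⊔ Ideal.span (S : Set Q) →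
      y * b ∈ K ⊔ Ideal.span ((S.image (fun s => y * s) : Finset Q) : Set Q) := by
    intro K y S b hb
    obtain ⟨k, hk, t, ht, rfl⟩ := Submodule.mem_sup.1 hb
    rw [mul_add]
    refine Submodule.add_mem_sup (Ideal.mul_mem_left _ _ hk) ?_
    rw [Finset.coe_image]
    have : Ideal.span ((fun s => y * s) '' (S : Set Q)) = Ideal.span {y} * Ideal.span (S : Set Q) := by
      rw [Ideal.span_mul_span']
      simp [Set.singleton_mul]
    rw [this]
    exact Ideal.mul_mem_mul (Ideal.mem_span_singleton_self _) ht
  induction hB using Finset.Nonempty.cons_induction with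
  | singleton y =>
    intro d
    rw [Finset.card_singleton, Nat.multichoose_one]
    induction d with
    | zero =>
      intro K J _ _ h
      exact htop J K 1 le_rfl (by rwa [pow_zero, Ideal.one_eq_top, top_le_iff] at h)
    | succ d ih =>
      intro K J hq hKJ h
      by_cases hJ : J = ⊤
      · exact htop J K 1 le_rfl hJ
      have hJq : J ≤ maximalIdeal Q := le_maximalIdeal hJ
      have hq' : maximalIdeal Q ≤ K ⊔ Ideal.span {x y} := by
        simpa [famSpan] using hq
      obtain ⟨S, hS, hSJ, hSK⟩ := ih K (J.colon {x y}) hq (hKJ.trans Ideal.le_colon)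
        (hcol J _ d (hm y) h)
      refine ⟨S.image (fun s => x y * s), Finset.card_image_le.trans hS, ?_, ?_⟩
      · intro s hs
        obtain ⟨r, hr, rfl⟩ := Finset.mem_image.1 hs
        have := Submodule.mem_colon_singleton.1 (hSJ r hr)
        rwa [smul_eq_mul, mul_comm] at this
      · intro a ha
        obtain ⟨k, hk, t, ht, rfl⟩ := Submodule.mem_sup.1 (hq' (hJq ha))
        obtain ⟨b, rfl⟩ := Ideal.mem_span_singleton'.1 ht
        have hb : b ∈ J.colon {x y} := by
          rw [Submodule.mem_colon_singleton, smul_eq_mul]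
          exact (Ideal.add_mem_iff_right _ (hKJ hk)).1 ha
        refine Ideal.add_mem _ (Ideal.mem_sup_left hk) ?_
        rw [mul_comm]
        exact hmulS K (x y) S b (hSK hb)
  | cons y B hyB hBne ih =>
    intro d
    rw [Finset.card_cons]
    induction d with
    | zero =>
      intro K J _ _ h
      exact htop J K _ (by simp) (by rwa [pow_zero, Ideal.one_eq_top, top_le_iff] at h)
    | succ d ihd =>
      intro K J hq hKJ h
      rw [Nat.multichoose_succ_succ]
      obtain ⟨S, hS, hSJ, hSK⟩ := ihd K (J.colon {x y}) hq (hKJ.trans Ideal.le_colon)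
        (hcol J _ d (hm y) h)
      obtain ⟨S', hS', hSJ', hSK'⟩ := ih (d + 1) (K ⊔ Ideal.span {x y}) (J ⊔ Ideal.span {x y}) (by
          rw [Finset.cons_eq_insert, famSpan_insert] at hq
          rwa [sup_assoc]) (sup_le_sup_right hKJ _) (h.trans le_sup_left)
      have hch : ∀ s : Q, ∃ j : Q, s ∈ J ⊔ Ideal.span {x y} → j ∈ J ∧ ∃ b, s = j + b * x y := by
        intro s
        by_cases hs : s ∈ J ⊔ Ideal.span {x y}
        · obtain ⟨j, hj, t, ht, rfl⟩ := Submodule.mem_sup.1 hs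
          obtain ⟨b, rfl⟩ := Ideal.mem_span_singleton'.1 ht
          exact ⟨j, fun _ => ⟨hj, b, rfl⟩⟩
        · exact ⟨0, fun h => absurd h hs⟩
      choose φ hφ using hch
      have hφJ : Ideal.span ((S'.image φ : Finset Q) : Set Q) ≤ J := by
        refine Ideal.span_le.2 fun s hs => ?_
        obtain ⟨r, hr, rfl⟩ := Finset.mem_image.1 hs
        exact (hφ r (hSJ' r hr)).1
      refine ⟨S'.image φ ∪ S.image (fun s => x y * s), ?_, ?_, ?_⟩
      · exact (Finset.card_union_le _ _).trans
          (Nat.add_le_add (Finset.card_image_le.trans hS') (Finset.card_image_le.trans hS))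
      · intro s hs
        rcases Finset.mem_union.1 hs with hs | hs
        · exact hφJ (Ideal.subset_span hs)
        · obtain ⟨r, hr, rfl⟩ := Finset.mem_image.1 hs
          have := Submodule.mem_colon_singleton.1 (hSJ r hr)
          rwa [smul_eq_mul, mul_comm] at this
      · intro a ha
        have hle : K ⊔ Ideal.span {x y} ⊔ Ideal.span (S' : Set Q) ≤
            (K ⊔ Ideal.span ((S'.image φ : Finset Q) : Set Q)) ⊔ Ideal.span {x y} := by
          refine sup_le (sup_le (le_sup_of_le_left le_sup_left) le_sup_right)
            (Ideal.span_le.2 fun s hs => ?_)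
          obtain ⟨_, b, hb⟩ := hφ s (hSJ' s hs)
          rw [hb]
          refine Submodule.add_mem_sup (Ideal.mem_sup_right (Ideal.subset_span ?_))
            (Ideal.mul_mem_left _ _ (Ideal.mem_span_singleton_self _))
          exact Finset.mem_image_of_mem φ hs
        obtain ⟨p, hp, t, ht, rfl⟩ := Submodule.mem_sup.1 (hle (hSK' (Ideal.mem_sup_left ha)))
        obtain ⟨b, rfl⟩ := Ideal.mem_span_singleton'.1 ht
        have hb : b ∈ J.colon {x y} := by
          rw [Submodule.mem_colon_singleton, smul_eq_mul]
          exact (Ideal.add_mem_iff_right _ (sup_le hKJ hφJ hp)).1 ha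
        rw [Finset.coe_union, Ideal.span_union]
        refine Ideal.add_mem _ (sup_mono_right _ le_sup_left hp) ?_
        rw [mul_comm]
        exact sup_mono_right _ le_sup_right (hmulS K (x y) S b (hSK hb))

/-- Double annihilator property. -/
theorem double_colon {Q : Type*} [CommRing Q] [IsLocalRing Q] [IsNoetherianRing Q]
    (I : Ideal Q) (hI : HasTypeOne I) (N : ℕ) (hN : maximalIdeal Q ^ N ≤ I)
    (M : Ideal Q) (hM : I ≤ M) (w : Q) (hw : w ∉ M) :
    ∃ g, (∀ a ∈ M, g * a ∈ I) ∧ g * w ∉ I := by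
  obtain ⟨σ, hσ, hcol⟩ := hI
  have hσq : ∀ r ∈ maximalIdeal Q, r * σ ∈ I := by
    intro r hr
    have : σ ∈ I.colon (maximalIdeal Q : Set Q) := by
      rw [hcol]; exact Ideal.mem_sup_right (Ideal.mem_span_singleton_self _)
    have := Submodule.mem_colon.1 this r hr
    rwa [smul_eq_mul, mul_comm] at this
  have hsoc : ∀ z, (∀ r ∈ maximalIdeal Q, r * z ∈ I) → ∃ e, z - e * σ ∈ I := by
    intro z hz
    have : z ∈ I.colon (maximalIdeal Q : Set Q) := by
      rw [Submodule.mem_colon]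
      intro r hr
      rw [smul_eq_mul, mul_comm]; exact hz r hr
    rw [hcol] at this
    obtain ⟨i, hi, t, ht, rfl⟩ := Submodule.mem_sup.1 this
    obtain ⟨e, rfl⟩ := Ideal.mem_span_singleton'.1 ht
    exact ⟨e, by simpa using hi⟩
  let C : Ideal Q → Prop := fun P => ∀ w ∉ P, ∃ g, (∀ a ∈ P, g * a ∈ I) ∧ g * w ∉ I
  have hCI : C I := fun w hw => ⟨1, fun a ha => by simpa using ha, by simpa using hw⟩
  have hstep : ∀ P z, C P → z ∉ P → (∀ r ∈ maximalIdeal Q, r * z ∈ P) →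
      C (P ⊔ Ideal.span {z}) := by
    intro P z hC hz hrz
    -- normalised functional
    have hmem : ∀ g, (∀ a ∈ P, g * a ∈ I) → g * z ∈ I → ∀ a ∈ P ⊔ Ideal.span {z}, g * a ∈ I := by
      intro g hg hgz a ha
      obtain ⟨i, hi, t, ht, rfl⟩ := Submodule.mem_sup.1 ha
      obtain ⟨e, rfl⟩ := Ideal.mem_span_singleton'.1 ht
      rw [mul_add, mul_left_comm]
      exact Ideal.add_mem _ (hg i hi) (Ideal.mul_mem_left _ _ hgz)
    have hgz : ∀ g, (∀ a ∈ P, g * a ∈ I) → ∃ e, g * z - e * σ ∈ I := by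
      intro g hg
      refine hsoc _ fun r hr => ?_
      rw [mul_left_comm]
      exact hg _ (hrz r hr)
    obtain ⟨g, hg, hgσ⟩ : ∃ g, (∀ a ∈ P, g * a ∈ I) ∧ g * z - σ ∈ I := by
      obtain ⟨g, hg, hgn⟩ := hC z hz
      obtain ⟨e, he⟩ := hgz g hg
      have heu : IsUnit e := by
        by_contra hne
        apply hgn
        have := Ideal.add_mem _ he (hσq e ((mem_maximalIdeal e).2 hne))
        simpa using this
      obtain ⟨u, hu⟩ := heu.exists_left_inv
      refine ⟨u * g, fun a ha => ?_, ?_⟩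
      · rw [mul_assoc]; exact Ideal.mul_mem_left _ _ (hg a ha)
      · have h := Ideal.mul_mem_left _ u he
        have h2 : u * g * z - σ = u * (g * z - e * σ) := by linear_combination σ * hu
        rwa [h2]
    intro w hw
    by_cases h1 : ∀ r ∈ maximalIdeal Q, r * (g * w) ∈ I
    · obtain ⟨c, hc⟩ := hsoc _ h1
      have hwc : w - c * z ∉ P := by
        intro hP
        apply hw
        have : w = (w - c * z) + c * z := by ring
        rw [this]
        exact Submodule.add_mem_sup hP
          (Ideal.mul_mem_left _ _ (Ideal.mem_span_singleton_self _))
      obtain ⟨g2, hg2, hg2n⟩ := hC _ hwc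
      obtain ⟨e, he⟩ := hgz g2 hg2
      have hGz : (g2 - e * g) * z ∈ I := by
        have : (g2 - e * g) * z = (g2 * z - e * σ) - e * (g * z - σ) := by ring
        rw [this]
        exact Ideal.sub_mem _ he (Ideal.mul_mem_left _ _ hgσ)
      refine ⟨g2 - e * g, hmem _ (fun a ha => ?_) hGz, fun hbad => hg2n ?_⟩
      · rw [sub_mul, mul_assoc]
        exact Ideal.sub_mem _ (hg2 a ha) (Ideal.mul_mem_left _ _ (hg a ha))
      · have : g2 * (w - c * z) = (g2 - e * g) * w - c * ((g2 - e * g) * z)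
            + e * ((g * w - c * σ) - c * (g * z - σ)) := by ring
        rw [this]
        exact Ideal.add_mem _ (Ideal.sub_mem _ hbad (Ideal.mul_mem_left _ _ hGz))
          (Ideal.mul_mem_left _ _ (Ideal.sub_mem _ hc (Ideal.mul_mem_left _ _ hgσ)))
    · push Not at h1
      obtain ⟨r, hr, hrn⟩ := h1
      refine ⟨r * g, hmem _ (fun a ha => ?_) ?_, by rwa [mul_assoc]⟩
      · rw [mul_assoc]; exact Ideal.mul_mem_left _ _ (hg a ha)
      · have : r * g * z = r * (g * z - σ) + r * σ := by ring
        rw [this]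
        exact Ideal.add_mem _ (Ideal.mul_mem_left _ _ hgσ) (hσq r hr)
  obtain ⟨P, ⟨hIP, hPM, hCP⟩, hmax⟩ := set_has_maximal_iff_noetherian.2
    (inferInstance : IsNoetherian Q Q) {P : Ideal Q | I ≤ P ∧ P ≤ M ∧ C P} ⟨I, le_rfl, hM, hCI⟩
  have hPeq : P = M := by
    by_contra hne
    obtain ⟨a, haM, haP⟩ := Set.not_subset.1 (fun h : (M : Set Q) ⊆ P => hne (le_antisymm hPM h))
    -- find a socle element
    have hex : ∃ n, ∀ r ∈ maximalIdeal Q ^ n, r * a ∈ P :=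
      ⟨N, fun r hr => Ideal.mul_mem_right _ _ (hIP (hN hr))⟩
    classical
    have hspec := Nat.find_spec hex
    have hpos : Nat.find hex ≠ 0 := by
      intro h0
      rw [h0] at hspec
      exact haP (by simpa using hspec 1 (by simp))
    obtain ⟨k, hk⟩ := Nat.exists_eq_succ_of_ne_zero hpos
    have hmin := Nat.find_min hex (m := k) (by omega)
    push Not at hmin
    obtain ⟨r, hr, hra⟩ := hmin
    rw [hk] at hspec
    have hC' := hstep P (r * a) hCP hra (fun t ht => by
      rw [← mul_assoc]
      exact hspec _ (by rw [Nat.succ_eq_add_one, pow_succ']; exact Ideal.mul_mem_mul ht hr))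
    refine hmax (P ⊔ Ideal.span {r * a}) ⟨hIP.trans le_sup_left, sup_le hPM ?_, hC'⟩ ?_
    · rw [Ideal.span_singleton_le_iff_mem]; exact Ideal.mul_mem_left _ _ haM
    · refine lt_of_le_of_ne le_sup_left fun h => hra ?_
      rw [h]
      exact Ideal.mem_sup_right (Ideal.mem_span_singleton_self _)
  subst hPeq
  exact hCP w hw

theorem permReg_of_isRegular {Q : Type*} [CommRing Q] [IsLocalRing Q] [IsNoetherianRing Q]
    (L : List Q) (hL : RingTheory.Sequence.IsRegular Q L) : PermReg (fun i : Fin L.length => L.get i) := by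
  intro A i hi a ha
  set x : Fin L.length → Q := fun i => L.get i with hx
  set L' : List (Fin L.length) := A.toList ++ (i :: (Aᶜ.erase i).toList) with hL'
  have hperm : List.Perm L (L'.map x) := by
    have h1 : (List.finRange L.length).map x = L := List.map_get_finRange L
    refine (List.Perm.of_eq h1.symm).trans ?_
    refine List.Perm.map _ ?_
    refine (List.perm_ext_iff_of_nodup (List.nodup_finRange _) ?_).2 ?_
    · rw [hL', List.nodup_append]
      refine ⟨A.nodup_toList, ?_, ?_⟩
      · rw [List.nodup_cons]
        exact ⟨by simp, Finset.nodup_toList _⟩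
      · intro b hb c hc h
        subst h
        simp only [Finset.mem_toList] at hb
        rcases List.mem_cons.1 hc with rfl | hc
        · exact hi hb
        · simp [hb] at hc
    · intro b
      simp only [List.mem_finRange, hL', List.mem_append, Finset.mem_toList, List.mem_cons,
        Finset.mem_erase, Finset.mem_compl, true_iff]
      tauto
  have hreg := (IsLocalRing.isRegular_of_perm hL hperm).toIsWeaklyRegular
  have h := hreg.regular_mod_prev A.card (by simp [hL'])
  have htake : (L'.map x).take A.card = A.toList.map x := by
    rw [hL', List.map_append, List.take_left' (by simp)]
  have hget : (L'.map x)[A.card]'(by simp [hL']) = x i := by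
    simp [hL']
  have hspan : (Ideal.ofList ((L'.map x).take A.card) • ⊤ : Submodule Q Q) = famSpan x A := by
    rw [htake, smul_eq_mul, Ideal.mul_top, famSpan]
    change Ideal.span _ = Ideal.span _
    congr 1
    ext b
    simp
  rw [hget, hspan] at h
  have h2 : (Submodule.Quotient.mk a : Q ⧸ (famSpan x A)) = 0 := by
    apply h
    change x i • (Submodule.Quotient.mk a : Q ⧸ (famSpan x A)) = x i • (0 : Q ⧸ (famSpan x A))
    rw [smul_zero, ← Submodule.Quotient.mk_smul, Submodule.Quotient.mk_eq_zero]
    exact ha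
  exact (Submodule.Quotient.mk_eq_zero _).1 h2

theorem not_one_two {Q : Type*} [CommRing Q] [IsLocalRing Q] (J : Ideal Q)
    (h1 : HasTypeOne J) (h2 : HasTypeTwo J) : False := by
  obtain ⟨z, _, hz⟩ := h1
  obtain ⟨x, y, hxy, hind⟩ := h2
  have hzq : ∀ r ∈ maximalIdeal Q, r * z ∈ J := by
    intro r hr
    have : z ∈ J.colon (maximalIdeal Q : Set Q) := by
      rw [hz]; exact Ideal.mem_sup_right (Ideal.mem_span_singleton_self _)
    have := Submodule.mem_colon.1 this r hr
    rwa [smul_eq_mul, mul_comm] at this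
  have key : ∀ t : Q, t ∈ Ideal.span {x, y} → ∃ e, t - e * z ∈ J := by
    intro t ht
    have : t ∈ J ⊔ Ideal.span {z} := by
      rw [← hz, hxy]; exact Ideal.mem_sup_right ht
    obtain ⟨i, hi, r, hr, hir⟩ := Submodule.mem_sup.1 this
    obtain ⟨e, he⟩ := Ideal.mem_span_singleton'.1 hr
    refine ⟨e, ?_⟩
    rw [← hir, ← he, add_sub_cancel_right]
    exact hi
  obtain ⟨α, hα⟩ := key x (Ideal.subset_span (Set.mem_insert _ _))
  obtain ⟨β, hβ⟩ := key y (Ideal.subset_span (Set.mem_insert_of_mem _ (Set.mem_singleton _)))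
  have h := hind β (-α) (by
    have : β * x + -α * y = β * (x - α * z) - α * (y - β * z) := by ring
    rw [this]
    exact Ideal.sub_mem _ (Ideal.mul_mem_left _ _ hα) (Ideal.mul_mem_left _ _ hβ))
  have hα' : α ∈ maximalIdeal Q := by simpa using h.2
  have hxJ : x ∈ J := by
    have := Ideal.add_mem _ hα (hzq α hα')
    simpa using this
  have := (hind 1 0 (by simpa using hxJ)).1
  exact (Ideal.ne_top_iff_one _).1 (maximalIdeal.isMaximal Q).ne_top this

theorem iniDeg_bound {Q : Type*} [CommRing Q] [IsLocalRing Q] [IsNoetherianRing Q]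
    (L : List Q) (hL : RingTheory.Sequence.IsRegular Q L)
    (hLq : Ideal.span {x | x ∈ L} = maximalIdeal Q) (hlen : 2 ≤ L.length)
    (I : Ideal Q) (hI : HasTypeOne I) (u : ℕ) (hu : maximalIdeal Q ^ (2 * u + 2) ≤ I)
    (hle : I ≤ maximalIdeal Q ^ (u + 2)) : False := by
  classical
  set x : Fin L.length → Q := fun i => L.get i with hx
  have hfam : famSpan x Finset.univ = maximalIdeal Q := by
    rw [← hLq, famSpan]
    congr 1
    ext b
    simp [hx, List.mem_iff_get]
  have hm : ∀ i, x i ∈ maximalIdeal Q := by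
    intro i
    rw [← hfam]
    exact Ideal.subset_span ⟨i, by simp, rfl⟩
  have hreg : PermReg x := permReg_of_isRegular L hL
  -- generators of the colon ideal
  set J : Ideal Q := I.colon (maximalIdeal Q ^ (u + 2) : Ideal Q) with hJ
  obtain ⟨S, hS, hSJ, hJS⟩ := gens_bound x hm Finset.univ ⟨⟨0, by omega⟩, by simp⟩ u ⊥ J
    (by rw [hfam]; exact le_sup_right) bot_le (by
      intro a ha
      rw [hJ, Submodule.mem_colon]
      intro b hb
      refine hu ?_
      rw [show 2 * u + 2 = u + (u + 2) by ring, pow_add]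
      exact Ideal.mul_mem_mul ha hb)
  rw [bot_sup_eq] at hJS
  obtain ⟨v, hv, hvi⟩ := exists_indep x hreg hm Finset.univ ∅ (by simp)
    (by rw [hfam]; exact le_sup_right) (u + 1)
  rw [famSpan_empty, bot_sup_eq] at hvi
  rw [hfam] at hv hvi
  rw [Finset.card_univ, Fintype.card_fin] at hS
  have hI' := hI
  obtain ⟨z, hz, hcol⟩ := hI
  have hzq : ∀ r ∈ maximalIdeal Q, r * z ∈ I := by
    intro r hr
    have : z ∈ I.colon (maximalIdeal Q : Set Q) := by
      rw [hcol]; exact Ideal.mem_sup_right (Ideal.mem_span_singleton_self _)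
    have := Submodule.mem_colon.1 this r hr
    rwa [smul_eq_mul, mul_comm] at this
  have hpair : ∀ (g : S) j, ∃ e : Q, (g : Q) * v j - e * z ∈ I := by
    intro g j
    have : (g : Q) * v j ∈ I.colon (maximalIdeal Q : Set Q) := by
      rw [Submodule.mem_colon]
      intro r hr
      have h1 := Submodule.mem_colon.1 (hSJ g g.2) (v j * r) (by
        rw [SetLike.mem_coe, pow_succ _ (u + 1)]
        exact Ideal.mul_mem_mul (hv j) hr)
      rw [smul_eq_mul] at h1 ⊢
      rwa [mul_assoc]
    rw [hcol] at this
    obtain ⟨i, hi, t, ht, hit⟩ := Submodule.mem_sup.1 this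
    obtain ⟨e, rfl⟩ := Ideal.mem_span_singleton'.1 ht
    exact ⟨e, by rw [← hit]; simpa using hi⟩
  choose α hα using hpair
  -- a nontrivial relation over the residue field
  have hcard : S.card < Nat.multichoose (Finset.univ : Finset (Fin L.length)).card (u + 1) := by
    rw [Finset.card_univ, Fintype.card_fin]
    obtain ⟨n, hn⟩ : ∃ n, L.length = n + 2 := ⟨L.length - 2, by omega⟩
    rw [hn] at hS ⊢
    rw [show n + 2 = (n + 1) + 1 from rfl, Nat.multichoose_succ_succ]
    have : 0 < Nat.multichoose (n + 1) (u + 1) := by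
      rw [Nat.multichoose_eq]
      exact Nat.choose_pos (by omega)
    have h2 : n + 2 = (n + 1) + 1 := rfl
    rw [h2] at hS
    omega
  let M : Matrix S (Fin (Nat.multichoose (Finset.univ : Finset (Fin L.length)).card (u + 1)))
    (ResidueField Q) := Matrix.of fun g j => residue Q (α g j)
  obtain ⟨c, hc0, hc⟩ : ∃ c, c ≠ 0 ∧ M.mulVec c = 0 := by
    obtain ⟨c, hc, hc0⟩ := (Submodule.ne_bot_iff _).1
      (LinearMap.ker_ne_bot_of_finrank_lt (f := M.mulVecLin) (by
        rw [Module.finrank_fintype_fun_eq_card, Module.finrank_fintype_fun_eq_card,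
          Fintype.card_coe, Fintype.card_fin]
        exact hcard))
    exact ⟨c, hc0, hc⟩
  choose d hd using fun j => residue_surjective (R := Q) (c j)
  have hdot : ∀ g : S, ∑ j, α g j * d j ∈ maximalIdeal Q := by
    intro g
    rw [← residue_eq_zero_iff, map_sum]
    have h := congrFun hc g
    refine Eq.trans (Finset.sum_congr rfl fun j _ => ?_) h
    rw [map_mul, hd j]
    rfl
  set w : Q := ∑ j, d j * v j with hw
  have hwn : w ∉ maximalIdeal Q ^ (u + 2) := by
    intro hwm
    apply hc0
    funext j
    rw [← hd j]
    exact (residue_eq_zero_iff _).2 (hvi d hwm j)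
  have hwg : ∀ g ∈ S, g * w ∈ I := by
    intro g hg
    have : g * w = ∑ j, d j * (g * v j - α ⟨g, hg⟩ j * z) + (∑ j, α ⟨g, hg⟩ j * d j) * z := by
      rw [hw, Finset.mul_sum, Finset.sum_mul, ← Finset.sum_add_distrib]
      exact Finset.sum_congr rfl fun j _ => by ring
    rw [this]
    exact Ideal.add_mem _ (Ideal.sum_mem _ fun j _ => Ideal.mul_mem_left _ _ (hα ⟨g, hg⟩ j))
      (hzq _ (hdot ⟨g, hg⟩))
  obtain ⟨g, hg, hgw⟩ := double_colon I hI' _ hu (maximalIdeal Q ^ (u + 2)) hle w hwn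
  have hgJ : g ∈ Ideal.span (S : Set Q) := hJS (by
    rw [hJ, Submodule.mem_colon]; exact hg)
  have hsub : Ideal.span (S : Set Q) ≤ I.colon {w} := by
    refine Ideal.span_le.2 fun s hs => ?_
    rw [SetLike.mem_coe, Submodule.mem_colon_singleton]
    exact hwg s hs
  exact hgw (by simpa using Submodule.mem_colon_singleton.1 (hsub hgJ))

theorem le_of_principal {Q : Type*} [CommRing Q] [IsLocalRing Q] (x : Q)
    (hx : maximalIdeal Q = Ideal.span {x}) (I1 I2 : Ideal Q) (s1 s2 : ℕ) (hle : s1 ≤ s2)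
    (h1 : maximalIdeal Q ^ (s1 + 1) ≤ I1) (h2 : ¬ maximalIdeal Q ^ s2 ≤ I2) : I2 ≤ I1 := by
  intro a ha
  apply h1
  have key : ∀ e, e ≤ s1 + 1 → a ∈ maximalIdeal Q ^ e := by
    intro e
    induction e with
    | zero => intro _; simp
    | succ e ih =>
      intro he
      have hae := ih (by omega)
      rw [hx, Ideal.span_singleton_pow] at hae
      obtain ⟨c, rfl⟩ := Ideal.mem_span_singleton'.1 hae
      by_cases hc : c ∈ maximalIdeal Q
      · rw [pow_succ']
        refine Ideal.mul_mem_mul hc ?_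
        rw [hx]
        exact Ideal.pow_mem_pow (Ideal.mem_span_singleton_self _) _
      · exfalso
        have hcu : IsUnit c := by
          by_contra h; exact hc ((mem_maximalIdeal c).2 h)
        have hxe : x ^ e ∈ I2 := (Ideal.unit_mul_mem_iff_mem I2 hcu).1 ha
        apply h2
        refine (Ideal.pow_le_pow_right (show e ≤ s2 by omega)).trans ?_
        rw [hx, Ideal.span_singleton_pow, Ideal.span_singleton_le_iff_mem]
        exact hxe
  exact key _ le_rfl

/-- With `R1, R2` Gorenstein of socle degrees `s1 ≤ s2` and
initial degrees `t1, t2`, if `R = Q/(I1 ∩ I2)` has type 2 and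
`⌈(s2+1)/2⌉ = t2`, then `t1 ≤ t2 ≤ s1 ≤ s2 < 2 s1`. -/
theorem stmt5 (Q : Type*) [CommRing Q] [IsLocalRing Q] [IsNoetherianRing Q]
    (hreg : IsRegularLocal Q)
    (I1 I2 : Ideal Q)
    (h1p : I1.IsPrimary) (h1r : I1.radical = maximalIdeal Q)
    (h2p : I2.IsPrimary) (h2r : I2.radical = maximalIdeal Q)
    (h1q2 : I1 ≤ maximalIdeal Q ^ 2) (h2q2 : I2 ≤ maximalIdeal Q ^ 2)
    (h1gor : HasTypeOne I1) (h2gor : HasTypeOne I2)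
    (s1 s2 t1 t2 : ℕ)
    (hs1 : SocDeg I1 s1) (hs2 : SocDeg I2 s2) (hle : s1 ≤ s2)
    (ht1 : IniDeg I1 t1) (ht2 : IniDeg I2 t2)
    (htype2 : HasTypeTwo (I1 ⊓ I2))
    (hceil : (s2 + 2) / 2 = t2) :
    t1 ≤ t2 ∧ t2 ≤ s1 ∧ s1 ≤ s2 ∧ s2 < 2 * s1 := by
  have hnot : ¬ I2 ≤ I1 := by
    intro h
    rw [inf_eq_right.2 h] at htype2
    exact not_one_two I2 h2gor htype2
  have h2 : t2 ≤ s1 := by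
    by_contra hlt
    exact hnot (ht2.1.trans ((Ideal.pow_le_pow_right (by omega)).trans hs1.2))
  refine ⟨?_, h2, hle, by omega⟩
  by_contra hlt
  obtain ⟨L, hL, hLq⟩ := hreg
  obtain ⟨u, rfl⟩ : ∃ u, t2 = u + 1 := ⟨t2 - 1, by omega⟩
  by_cases hlen : 2 ≤ L.length
  · exact iniDeg_bound L hL hLq hlen I1 h1gor u
      ((Ideal.pow_le_pow_right (by omega)).trans hs1.2)
      (ht1.1.trans (Ideal.pow_le_pow_right (by omega)))
  · match L, hLq, hlen with
    | [], hLq, _ =>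
      have : maximalIdeal Q = Ideal.span {0} := by rw [← hLq]; simp
      exact hnot (le_of_principal 0 this I1 I2 s1 s2 hle hs1.2 hs2.1)
    | [x], hLq, _ =>
      have : maximalIdeal Q = Ideal.span {x} := by rw [← hLq]; simp
      exact hnot (le_of_principal x this I1 I2 s1 s2 hle hs1.2 hs2.1)
    | _ :: _ :: _, _, hlen => simp at hlen
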